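/- arXiv:1703.08834 — 5 statements merged into one kernel-verified Lean document; each statement's English description precedes it below -/
import Mathlib

section
/- Let n be a natural number with at least two distinct prime factors. Then the following are equivalent: (i) n is a product of two distinct primes; (ii) 𝒮(ℤ_n) is a separating set of the power graph 𝒢(ℤ_n); (iii) κ(𝒢(ℤ_n)) = φ(n) + 1. -/
open SimpleGraph

/-- The power graph of a (multiplicative) group: distinct `x, y` are adjacent
iff one is a power of the other. -/
def powerGraph (G : Type*) [Group G] : SimpleGraph G where
  Adj x y := x ≠ y ∧ (x ∈ Subgroup.zpowers y ∨ y ∈ Subgroup.zpowers x)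
  symm := by
    constructor
    rintro x y ⟨h1, h2⟩
    exact ⟨h1.symm, h2.symm⟩
  loopless := by
    constructor
    rintro x ⟨h1, -⟩
    exact h1 rfl

/-- The power graph of the additive group `ℤ_n`. -/
def powerGraphZ (n : ℕ) : SimpleGraph (ZMod n) where
  Adj x y := x ≠ y ∧ (x ∈ AddSubgroup.zmultiples y ∨ y ∈ AddSubgroup.zmultiples x)
  symm := by
    constructor
    rintro x y ⟨h1, h2⟩
    exact ⟨h1.symm, h2.symm⟩
  loopless := by
    constructor
    rintro x ⟨h1, -⟩
    exact h1 rfl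

/-- Number of connected components of a graph. -/
noncomputable def numComponents {V : Type*} (Γ : SimpleGraph V) : ℕ :=
  Nat.card Γ.ConnectedComponent

/-- `T` is a separating set of `Γ`: deleting `T` increases the number of components. -/
def IsSepSet {V : Type*} (Γ : SimpleGraph V) (T : Set V) : Prop :=
  numComponents Γ < numComponents (Γ.induce Tᶜ)

/-- A separating set is minimal if no nonempty proper subset of it is separating. -/
def IsMinimalSepSet {V : Type*} (Γ : SimpleGraph V) (T : Set V) : Prop :=
  IsSepSet Γ T ∧ ∀ S : Set V, S ⊆ T → S ≠ T → S.Nonempty → ¬ IsSepSet Γ S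

/-- A separating set of least cardinality. -/
def IsMinimumSepSet {V : Type*} (Γ : SimpleGraph V) (T : Set V) : Prop :=
  IsSepSet Γ T ∧ ∀ S : Set V, IsSepSet Γ S → T.ncard ≤ S.ncard

/-- Vertex connectivity: the least number of vertices whose removal leaves a
disconnected or one-vertex graph. -/
noncomputable def kappa {V : Type*} (Γ : SimpleGraph V) : ℕ :=
  sInf {k | ∃ S : Set V, S.ncard = k ∧
    (¬ (Γ.induce Sᶜ).Preconnected ∨ (Sᶜ : Set V).ncard = 1)}

/-- `𝒮(ℤ_n)`: the identity together with the generators of `ℤ_n`. -/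
def genSet (n : ℕ) : Set (ZMod n) :=
  {x | AddSubgroup.zmultiples x = ⊤} ∪ {0}

/-- `ℤ̃_n = ℤ_n − 𝒮(ℤ_n)`. -/
def tildeVerts (n : ℕ) : Set (ZMod n) := (genSet n)ᶜ

/-- `𝒢̃(ℤ_n)`: the subgraph of the power graph induced on `ℤ̃_n`. -/
def tildeGraph (n : ℕ) : SimpleGraph (tildeVerts n) :=
  (powerGraphZ n).induce (tildeVerts n)

/-- The `≈`-class of `x`: elements generating the same cyclic subgroup. -/
def simClass {G : Type*} [Group G] (x : G) : Set G :=
  {y | Subgroup.zpowers y = Subgroup.zpowers x}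

/-- The `≈`-class in `ℤ_n`. -/
def simClassZ {n : ℕ} (x : ZMod n) : Set (ZMod n) :=
  {y | AddSubgroup.zmultiples y = AddSubgroup.zmultiples x}

/-- Neighbourhood of a set of vertices: vertices adjacent to some element of `A`,
excluding `A` itself. -/
def setNbhd {V : Type*} (Γ : SimpleGraph V) (A : Set V) : Set V :=
  (⋃ a ∈ A, Γ.neighborSet a) \ A

/-- The proper power graph: the power graph with the identity removed. -/
def properPowerGraph (G : Type*) [Group G] : SimpleGraph ({g : G | g ≠ 1}) :=
  (powerGraph G).induce {g : G | g ≠ 1}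

lemma mem_zm {n : ℕ} (x y : ZMod n) : x ∈ AddSubgroup.zmultiples y ↔ y ∣ x := by
  rw [AddSubgroup.mem_zmultiples_iff]
  constructor
  · rintro ⟨k, rfl⟩
    exact ⟨(k : ZMod n), by rw [zsmul_eq_mul, mul_comm]⟩
  · rintro ⟨c, rfl⟩
    obtain ⟨k, rfl⟩ := ZMod.intCast_surjective c
    exact ⟨k, by rw [zsmul_eq_mul, mul_comm]⟩

lemma adj_iff {n : ℕ} (x y : ZMod n) : (powerGraphZ n).Adj x y ↔ x ≠ y ∧ (y ∣ x ∨ x ∣ y) := by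
  rw [← mem_zm, ← mem_zm]; rfl

lemma mem_gen {n : ℕ} (x : ZMod n) : x ∈ genSet n ↔ IsUnit x ∨ x = 0 := by
  have : AddSubgroup.zmultiples x = ⊤ ↔ IsUnit x := by
    rw [isUnit_iff_dvd_one, ← mem_zm]
    constructor
    · intro h; rw [h]; trivial
    · intro h
      rw [eq_top_iff]
      intro y _
      rw [mem_zm] at h ⊢
      exact h.trans (one_dvd y)
  simp [genSet, this, or_comm]

lemma gen_dom {n : ℕ} {x : ZMod n} (hx : x ∈ genSet n) (y : ZMod n) (h : x ≠ y) :
    (powerGraphZ n).Adj x y := by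
  rw [adj_iff]
  refine ⟨h, ?_⟩
  rcases (mem_gen x).1 hx with h | rfl
  · exact Or.inr h.dvd
  · exact Or.inl (dvd_zero y)

lemma gen_ncard {n : ℕ} (hn : 2 ≤ n) : (genSet n).ncard = Nat.totient n + 1 := by
  haveI : NeZero n := ⟨by omega⟩
  haveI : Fact (1 < n) := ⟨by omega⟩
  have h : genSet n = insert 0 (Set.range ((↑) : (ZMod n)ˣ → ZMod n)) := by
    ext x
    rw [mem_gen, Set.mem_insert_iff, or_comm]; rfl
  rw [h, Set.ncard_insert_of_notMem _ (Set.toFinite _)]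
  · rw [← ZMod.card_units_eq_totient n, ← Nat.card_eq_fintype_card, ← Set.image_univ,
      Set.ncard_image_of_injective _ Units.val_injective, Set.ncard_univ]
  · rintro ⟨u, hu⟩
    exact u.ne_zero hu

lemma sub_of_not_pre {n : ℕ} {S : Set (ZMod n)}
    (h : ¬ ((powerGraphZ n).induce Sᶜ).Preconnected) : genSet n ⊆ S := by
  intro x hx
  by_contra hxS
  apply h
  have key : ∀ y : (Sᶜ : Set (ZMod n)), ((powerGraphZ n).induce Sᶜ).Reachable ⟨x, hxS⟩ y := by
    intro y
    by_cases hxy : x = y.1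
    · have : (⟨x, hxS⟩ : (Sᶜ : Set (ZMod n))) = y := Subtype.ext hxy
      rw [this]
    · apply SimpleGraph.Adj.reachable
      exact gen_dom hx y.1 hxy
  exact fun a b => (key a).symm.trans (key b)

lemma sep_iff {n : ℕ} (hn : 2 ≤ n) : IsSepSet (powerGraphZ n) (genSet n) ↔
    ¬ ((powerGraphZ n).induce (genSet n)ᶜ).Preconnected := by
  haveI : NeZero n := ⟨by omega⟩
  have h1 : (powerGraphZ n).Connected := by
    have key : ∀ y, (powerGraphZ n).Reachable 0 y := by
      intro y
      by_cases h : 0 = y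
      · rw [h]
      · exact (gen_dom ((mem_gen 0).2 (Or.inr rfl)) y h).reachable
    exact ⟨fun a b => (key a).symm.trans (key b)⟩
  have h2 : numComponents (powerGraphZ n) = 1 := by
    unfold numComponents
    rw [Nat.card_eq_one_iff_unique]
    exact ⟨h1.preconnected.subsingleton_connectedComponent,
      ⟨(powerGraphZ n).connectedComponentMk 0⟩⟩
  unfold IsSepSet
  rw [h2]
  unfold numComponents
  rw [Finite.one_lt_card_iff_nontrivial, ← not_subsingleton_iff_nontrivial, not_iff_not]
  constructor
  · intro h a b
    exact SimpleGraph.ConnectedComponent.exact (Subsingleton.elim _ _)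
  · exact fun h => h.subsingleton_connectedComponent

lemma prime_tilde {n r s : ℕ} (hn0 : n ≠ 0) (hr : r.Prime) (hs : s.Prime) (hrs : r ≠ s)
    (hrn : r ∣ n) (hsn : s ∣ n) : (r : ZMod n) ∈ (genSet n)ᶜ := by
  rw [Set.mem_compl_iff, mem_gen, not_or]
  constructor
  · rw [ZMod.isUnit_iff_coprime]
    intro h
    exact hr.one_lt.ne' (Nat.Coprime.eq_one_of_dvd h hrn)
  · rw [ZMod.natCast_eq_zero_iff]
    intro h
    exact hrs ((Nat.prime_dvd_prime_iff_eq hs hr).1 (hsn.trans h)).symm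

lemma exists_prime_dvd' {n : ℕ} (hn : n ≠ 0) (x : ZMod n) (hx : ¬ IsUnit x) :
    ∃ r : ℕ, r.Prime ∧ r ∣ n ∧ (r : ZMod n) ∣ x := by
  haveI : NeZero n := ⟨hn⟩
  have hv : ((x.val : ℕ) : ZMod n) = x := ZMod.natCast_zmod_val x
  rw [← hv, ZMod.isUnit_iff_coprime, Nat.Prime.not_coprime_iff_dvd] at hx
  obtain ⟨r, hr, h1, h2⟩ := hx
  refine ⟨r, hr, h2, ?_⟩
  rw [← hv]
  exact Nat.cast_dvd_cast h1

lemma pq_of_not_pre {n : ℕ} (hn : 2 ≤ n.primeFactors.card)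
    (h : ¬ ((powerGraphZ n).induce (genSet n)ᶜ).Preconnected) :
    ∃ p q : ℕ, p.Prime ∧ q.Prime ∧ p ≠ q ∧ n = p * q := by
  have hn0 : n ≠ 0 := by rintro rfl; simp at hn
  by_contra hpq
  apply h
  set Γ := (powerGraphZ n).induce (genSet n)ᶜ with hΓ
  have step : ∀ a b : ((genSet n)ᶜ : Set (ZMod n)), a.1 ∣ b.1 → Γ.Reachable a b := by
    intro a b hab
    by_cases e : a = b
    · rw [e]
    · apply SimpleGraph.Adj.reachable
      change (powerGraphZ n).Adj a.1 b.1
      rw [adj_iff]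
      exact ⟨fun h => e (Subtype.ext h), Or.inr hab⟩
  have main : ∀ (a b : ((genSet n)ᶜ : Set (ZMod n))) (r s : ℕ), r.Prime → s.Prime →
      r ∣ n → s ∣ n → a.1 = r → b.1 = s → Γ.Reachable a b := by
    intro a b r s hr hs hrn hsn ha hb
    by_cases e : r = s
    · subst e
      rw [Subtype.ext (ha.trans hb.symm)]
    · have hc : ((r * s : ℕ) : ZMod n) ∈ (genSet n)ᶜ := by
        rw [Set.mem_compl_iff, mem_gen, not_or]
        constructor
        · rw [ZMod.isUnit_iff_coprime]
          intro h
          exact hr.one_lt.ne' (Nat.Coprime.eq_one_of_dvd (h.coprime_dvd_left (dvd_mul_right r s)) hrn)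
        · rw [ZMod.natCast_eq_zero_iff]
          intro h
          apply hpq
          exact ⟨r, s, hr, hs, e, Nat.dvd_antisymm h
            (((Nat.coprime_primes hr hs).2 e).mul_dvd_of_dvd_of_dvd hrn hsn)⟩
      refine (step a ⟨_, hc⟩ ?_).trans (step b ⟨_, hc⟩ ?_).symm
      · rw [ha]; exact Nat.cast_dvd_cast (dvd_mul_right r s)
      · rw [hb]; exact Nat.cast_dvd_cast (dvd_mul_left s r)
  have red : ∀ a : ((genSet n)ᶜ : Set (ZMod n)), ∃ (r : ℕ) (c : ((genSet n)ᶜ : Set (ZMod n))),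
      r.Prime ∧ r ∣ n ∧ c.1 = r ∧ Γ.Reachable a c := by
    intro a
    have ha := a.2
    rw [Set.mem_compl_iff, mem_gen, not_or] at ha
    obtain ⟨r, hr, hrn, hra⟩ := exists_prime_dvd' hn0 a.1 ha.1
    obtain ⟨s, hs, hsr⟩ := Finset.exists_mem_ne (by omega : 1 < n.primeFactors.card) r
    have hs' := Nat.mem_primeFactors.1 hs
    have hm := prime_tilde hn0 hr hs'.1 hsr.symm hrn hs'.2.1
    exact ⟨r, ⟨_, hm⟩, hr, hrn, rfl, (step ⟨_, hm⟩ a hra).symm⟩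
  intro a b
  obtain ⟨r, c, hr, hrn, hc, hac⟩ := red a
  obtain ⟨s, d, hs, hsn, hd, hbd⟩ := red b
  exact hac.trans ((main c d r s hr hs hrn hsn hc hd).trans hbd.symm)

lemma not_pre_of_pq {p q : ℕ} (hp : p.Prime) (hq : q.Prime) (hpq : p ≠ q) :
    ¬ ((powerGraphZ (p * q)).induce (genSet (p * q))ᶜ).Preconnected := by
  have hn0 : p * q ≠ 0 := mul_ne_zero hp.ne_zero hq.ne_zero
  set n := p * q with hn
  intro h
  haveI : NeZero n := ⟨hn0⟩
  have hpqz : (p : ZMod n) * q = 0 := by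
    rw [← Nat.cast_mul]; exact ZMod.natCast_self n
  have both : ∀ x : ZMod n, (p : ZMod n) * x = 0 → (q : ZMod n) * x = 0 → x = 0 := by
    intro x h1 h2
    have hv : ((x.val : ℕ) : ZMod n) = x := ZMod.natCast_zmod_val x
    rw [← hv, ← Nat.cast_mul, ZMod.natCast_eq_zero_iff] at h1 h2
    rw [← hv, ZMod.natCast_eq_zero_iff]
    exact ((Nat.coprime_primes hp hq).2 hpq).mul_dvd_of_dvd_of_dvd
      (Nat.dvd_of_mul_dvd_mul_left hq.pos (by rw [mul_comm q p]; exact h2))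
      (Nat.dvd_of_mul_dvd_mul_left hp.pos h1)
  have one : ∀ x : ZMod n, ¬ IsUnit x → (p : ZMod n) * x = 0 ∨ (q : ZMod n) * x = 0 := by
    intro x hx
    obtain ⟨r, hr, hrn, c, rfl⟩ := exists_prime_dvd' hn0 x hx
    rcases (Nat.Prime.dvd_mul hr).1 hrn with h | h
    · rw [(Nat.prime_dvd_prime_iff_eq hr hp).1 h]
      right; rw [← mul_assoc, mul_comm (q : ZMod n), hpqz, zero_mul]
    · rw [(Nat.prime_dvd_prime_iff_eq hr hq).1 h]
      left; rw [← mul_assoc, hpqz, zero_mul]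
  have dv : ∀ x y : ZMod n, x ∈ (genSet n)ᶜ → y ∈ (genSet n)ᶜ → y ∣ x →
      ((q : ZMod n) * x = 0 ↔ (q : ZMod n) * y = 0) := by
    rintro x y hx hy ⟨c, rfl⟩
    rw [Set.mem_compl_iff, mem_gen, not_or] at hx hy
    constructor
    · intro h
      rcases one y hy.1 with h' | h'
      · exact absurd (both _ (by rw [← mul_assoc, h', zero_mul]) h) hx.2
      · exact h'
    · intro h
      rw [← mul_assoc, h, zero_mul]
  have hpm := prime_tilde hn0 hp hq hpq (dvd_mul_right p q) (dvd_mul_left q p)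
  have hqm := prime_tilde hn0 hq hp hpq.symm (dvd_mul_left q p) (dvd_mul_right p q)
  obtain ⟨w⟩ := h ⟨_, hpm⟩ ⟨_, hqm⟩
  have inv : ∀ (a b : ((genSet n)ᶜ : Set (ZMod n))),
      ((powerGraphZ n).induce (genSet n)ᶜ).Walk a b →
      ((q : ZMod n) * a.1 = 0 ↔ (q : ZMod n) * b.1 = 0) := by
    intro a b w
    induction w with
    | nil => rfl
    | @cons u v w hadj _ ih =>
      rw [← ih]
      have hadj' : (powerGraphZ n).Adj u.1 v.1 := hadj
      rw [adj_iff] at hadj'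
      rcases hadj'.2 with h | h
      · exact dv _ _ u.2 v.2 h
      · exact (dv _ _ v.2 u.2 h).symm
  have h1 := (inv _ _ w).1 (by rw [mul_comm]; exact hpqz)
  change (q : ZMod n) * (q : ZMod n) = 0 at h1
  rw [← Nat.cast_mul, ZMod.natCast_eq_zero_iff] at h1
  have h2 : p ∣ q * q := (dvd_mul_right p q).trans h1
  rcases (Nat.Prime.dvd_mul hp).1 h2 with h | h <;>
    exact hpq ((Nat.prime_dvd_prime_iff_eq hp hq).1 h)

lemma compl_two {n : ℕ} (hn : 2 ≤ n.primeFactors.card) : 2 ≤ ((genSet n)ᶜ).ncard := by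
  have hn0 : n ≠ 0 := by rintro rfl; simp at hn
  haveI : NeZero n := ⟨hn0⟩
  obtain ⟨p, hp, q, hq, hpq⟩ := Finset.one_lt_card.1 (by omega : 1 < n.primeFactors.card)
  have hp' := Nat.mem_primeFactors.1 hp
  have hq' := Nat.mem_primeFactors.1 hq
  have hpm := prime_tilde hn0 hp'.1 hq'.1 hpq hp'.2.1 hq'.2.1
  have hqm := prime_tilde hn0 hq'.1 hp'.1 hpq.symm hq'.2.1 hp'.2.1
  have : 1 < ((genSet n)ᶜ).ncard := by
    rw [Set.one_lt_ncard (Set.toFinite _)]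
    refine ⟨_, hpm, _, hqm, ?_⟩
    intro h
    rw [ZMod.natCast_eq_natCast_iff] at h
    have h3 : p ≡ q [MOD p] := h.of_dvd hp'.2.1
    have h4 : p ∣ q := (h3.dvd_iff dvd_rfl).1 dvd_rfl
    exact hpq ((Nat.prime_dvd_prime_iff_eq hp'.1 hq'.1).1 h4)
  exact this

/-- For `n` with at least two distinct prime factors, TFAE:
(i) `n` is a product of two distinct primes;
(ii) `𝒮(ℤ_n)` is a separating set of `𝒢(ℤ_n)`;
(iii) `κ(𝒢(ℤ_n)) = φ(n) + 1`. -/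
theorem stmt0 (n : ℕ) (hn : 2 ≤ n.primeFactors.card) :
    ((∃ p q : ℕ, p.Prime ∧ q.Prime ∧ p ≠ q ∧ n = p * q) ↔
      IsSepSet (powerGraphZ n) (genSet n)) ∧
    ((∃ p q : ℕ, p.Prime ∧ q.Prime ∧ p ≠ q ∧ n = p * q) ↔
      kappa (powerGraphZ n) = Nat.totient n + 1) := by
  have hn0 : n ≠ 0 := by rintro rfl; simp at hn
  haveI : NeZero n := ⟨hn0⟩
  have hn2 : 2 ≤ n := by
    rcases n with _ | _ | n
    · exact absurd rfl hn0
    · simp at hn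
    · omega
  have e : (∃ p q : ℕ, p.Prime ∧ q.Prime ∧ p ≠ q ∧ n = p * q) ↔
      ¬ ((powerGraphZ n).induce (genSet n)ᶜ).Preconnected := by
    refine ⟨?_, pq_of_not_pre hn⟩
    rintro ⟨p, q, hp, hq, hpq, rfl⟩
    exact not_pre_of_pq hp hq hpq
  refine ⟨e.trans (sep_iff hn2).symm, e.trans ?_⟩
  have hc2 := compl_two hn
  have hg := gen_ncard hn2
  have hadd := Set.ncard_add_ncard_compl (genSet n)
  constructor
  · intro h
    apply le_antisymm
    · exact Nat.sInf_le ⟨genSet n, hg, Or.inl h⟩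
    · refine le_csInf ⟨_, genSet n, hg, Or.inl h⟩ ?_
      rintro k ⟨S, rfl, hS | hS⟩
      · rw [← hg]; exact Set.ncard_le_ncard (sub_of_not_pre hS) (Set.toFinite _)
      · have := Set.ncard_add_ncard_compl S
        omega
  · intro h
    unfold kappa at h
    have hne := Nat.nonempty_of_sInf_eq_succ h
    have hm := Nat.sInf_mem hne
    rw [h] at hm
    obtain ⟨S, hSc, hS | hS⟩ := hm
    · have : genSet n = S := Set.eq_of_subset_of_ncard_le (sub_of_not_pre hS)
        (by omega) (Set.toFinite _)
      rw [this]; exact hS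
    · have := Set.ncard_add_ncard_compl S
      omega
end

section
/- Suppose n ∈ ℕ has at least two distinct prime factors, n is not a product of two distinct primes, and p_1 < p_2 < ⋯ < p_r (r ≥ 2) are the prime factors of n. Then for each 1 ≤ k ≤ r, the set ∪_{i=1, i≠k}^{r} (⟨\overline{p_i p_k}⟩ − {0̄}) is a minimal separating set of 𝒢̃(ℤ_n). -/
open SimpleGraph

theorem aux_dvd_val_natCast {n d m : ℕ} (hd : d ∣ n) :
    d ∣ ((m : ℕ) : ZMod n).val ↔ d ∣ m := by
  rw [ZMod.val_natCast, Nat.dvd_mod_iff hd]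

theorem aux_mem {n d : ℕ} [NeZero n] (hd : d ∣ n) (x : ZMod n) :
    x ∈ AddSubgroup.zmultiples ((d : ℕ) : ZMod n) ↔ d ∣ x.val := by
  constructor
  · rintro ⟨m, rfl⟩
    have : (fun z : ℤ => z • ((d : ℕ) : ZMod n)) m = (((m : ZMod n).val * d : ℕ) : ZMod n) := by
      simp
    rw [this, aux_dvd_val_natCast hd]
    exact Dvd.intro_left _ rfl
  · rintro ⟨c, hc⟩
    refine ⟨(c : ℤ), ?_⟩
    have : x = ((x.val : ℕ) : ZMod n) := by simp
    rw [this, hc]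
    simp [mul_comm]

theorem aux_trans {n d : ℕ} [NeZero n] (hd : d ∣ n) {x y : ZMod n}
    (h : x ∈ AddSubgroup.zmultiples y) (hy : d ∣ y.val) : d ∣ x.val := by
  rw [← aux_mem hd] at hy ⊢
  exact (AddSubgroup.zmultiples_le.2 hy) h

theorem aux_tilde {n : ℕ} [NeZero n] (x : ZMod n) :
    x ∈ tildeVerts n ↔ x ≠ 0 ∧ ∃ p ∈ n.primeFactors, p ∣ x.val := by
  have key : AddSubgroup.zmultiples x = ⊤ ↔ ¬ ∃ p ∈ n.primeFactors, p ∣ x.val := by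
    constructor
    · rintro h ⟨p, hp, hpx⟩
      have hpn := Nat.dvd_of_mem_primeFactors hp
      have h1 : ((1 : ℕ) : ZMod n) ∈ AddSubgroup.zmultiples x := by rw [h]; trivial
      have := aux_trans hpn h1 hpx
      rw [aux_dvd_val_natCast hpn] at this
      exact (Nat.prime_of_mem_primeFactors hp).one_lt.ne' (Nat.dvd_one.1 this)
    · intro h
      have hc : Nat.Coprime x.val n := by
        apply Nat.coprime_of_dvd
        intro p hp h1 h2
        exact h ⟨p, Nat.mem_primeFactors.2 ⟨hp, h2, NeZero.ne n⟩, h1⟩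
      have hu := ZMod.coe_mul_inv_eq_one x.val hc
      rw [eq_top_iff]
      intro y _
      refine ⟨((y * (x.val : ZMod n)⁻¹).val : ℤ), ?_⟩
      simp at hu
      simp [mul_assoc]
      rw [mul_comm _ x, hu, mul_one]
  simp only [tildeVerts, genSet, Set.mem_compl_iff, Set.mem_union, Set.mem_ofPred_eq,
    Set.mem_singleton_iff, key]
  rw [not_or, not_not, and_comm]

theorem aux_T {n k : ℕ} [NeZero n] (hk : k ∈ n.primeFactors) (x : tildeVerts n) :
    x ∈ (Subtype.val ⁻¹' (⋃ i ∈ n.primeFactors.erase k,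
          ((AddSubgroup.zmultiples (((i * k : ℕ) : ZMod n)) : Set (ZMod n)) \ {0})) :
            Set (tildeVerts n)) ↔
      k ∣ x.1.val ∧ ∃ i ∈ n.primeFactors, i ≠ k ∧ i ∣ x.1.val := by
  have hx := ((aux_tilde x.1).1 x.2).1
  have hkp := Nat.prime_of_mem_primeFactors hk
  simp only [Set.mem_preimage, Set.mem_iUnion, Set.mem_sdiff, SetLike.mem_coe,
    Set.mem_singleton_iff, hx, not_false_eq_true, and_true, Finset.mem_erase, exists_prop]
  constructor
  · rintro ⟨i, ⟨hik, hi⟩, h⟩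
    have hip := Nat.prime_of_mem_primeFactors hi
    have hd : i * k ∣ n := ((Nat.coprime_primes hip hkp).2 hik).mul_dvd_of_dvd_of_dvd
      (Nat.dvd_of_mem_primeFactors hi) (Nat.dvd_of_mem_primeFactors hk)
    rw [aux_mem hd] at h
    exact ⟨(Dvd.intro_left _ rfl).trans h, i, hi, hik, (Dvd.intro _ rfl).trans h⟩
  · rintro ⟨h1, i, hi, hik, h2⟩
    have hip := Nat.prime_of_mem_primeFactors hi
    have hc := (Nat.coprime_primes hip hkp).2 hik
    have hd : i * k ∣ n := hc.mul_dvd_of_dvd_of_dvd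
      (Nat.dvd_of_mem_primeFactors hi) (Nat.dvd_of_mem_primeFactors hk)
    exact ⟨i, ⟨hik, hi⟩, (aux_mem hd _).2 (hc.mul_dvd_of_dvd_of_dvd h2 h1)⟩

theorem aux_ne {n m q : ℕ} (hq : q ∣ n) (h : ¬ q ∣ m) : ((m : ℕ) : ZMod n) ≠ 0 := by
  intro h0
  rw [ZMod.natCast_eq_zero_iff] at h0
  exact h (hq.trans h0)

theorem aux_reach {n : ℕ} (S : Set (tildeVerts n)) (u v : (Sᶜ : Set (tildeVerts n)))
    (h : u.1.1 ∈ AddSubgroup.zmultiples v.1.1) :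
    ((tildeGraph n).induce Sᶜ).Reachable u v := by
  by_cases e : u = v
  · rw [e]
  · apply SimpleGraph.Adj.reachable
    refine ⟨fun h' => e (Subtype.ext (Subtype.ext h')), Or.inl h⟩

theorem aux_conn {n k : ℕ} [NeZero n] (hk : k ∈ n.primeFactors) (S : Set (tildeVerts n))
    (hS : ∀ x ∈ S, k ∣ x.1.val ∧ ∃ i ∈ n.primeFactors, i ≠ k ∧ i ∣ x.1.val)
    (t : tildeVerts n) (htS : t ∉ S)
    (ht : k ∣ t.1.val ∧ ∃ i ∈ n.primeFactors, i ≠ k ∧ i ∣ t.1.val) :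
    ((tildeGraph n).induce Sᶜ).Preconnected := by
  obtain ⟨htk, i, hi, hik, hti⟩ := ht
  have hkp := Nat.prime_of_mem_primeFactors hk
  have hkn := Nat.dvd_of_mem_primeFactors hk
  have hip := Nat.prime_of_mem_primeFactors hi
  have hin := Nat.dvd_of_mem_primeFactors hi
  have hk1 : ((k : ℕ) : ZMod n) ∈ tildeVerts n := (aux_tilde _).2
    ⟨aux_ne hin (fun h => hik ((Nat.prime_dvd_prime_iff_eq hip hkp).1 h)), k, hk,
      (aux_dvd_val_natCast hkn).2 dvd_rfl⟩
  have hk2 : (⟨_, hk1⟩ : tildeVerts n) ∉ S := by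
    intro h
    obtain ⟨-, j, hj, hjk, hjd⟩ := hS _ h
    rw [aux_dvd_val_natCast (Nat.dvd_of_mem_primeFactors hj)] at hjd
    exact hjk ((Nat.prime_dvd_prime_iff_eq (Nat.prime_of_mem_primeFactors hj) hkp).1 hjd)
  have mk : ∀ m p : ℕ, p ∈ n.primeFactors → p ∣ m → ¬ k ∣ m →
      ∃ v : (Sᶜ : Set (tildeVerts n)), v.1.1 = (m : ZMod n) := by
    intro m p hp hpm hkm
    have h1 : ((m : ℕ) : ZMod n) ∈ tildeVerts n := (aux_tilde _).2
      ⟨aux_ne hkn hkm, p, hp, (aux_dvd_val_natCast (Nat.dvd_of_mem_primeFactors hp)).2 hpm⟩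
    refine ⟨⟨⟨_, h1⟩, fun h => hkm ?_⟩, rfl⟩
    exact (aux_dvd_val_natCast hkn).1 (hS _ h).1
  let r : (Sᶜ : Set (tildeVerts n)) := ⟨⟨_, hk1⟩, hk2⟩
  have nd : ∀ p ∈ n.primeFactors, p ≠ k → ¬ k ∣ p := fun p hp hpk h =>
    hpk ((Nat.prime_dvd_prime_iff_eq hkp (Nat.prime_of_mem_primeFactors hp)).1 h).symm
  have main : ∀ v, ((tildeGraph n).induce Sᶜ).Reachable v r := by
    intro v
    by_cases hv : k ∣ v.1.1.val
    · exact aux_reach S v r ((aux_mem hkn _).2 hv)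
    · obtain ⟨-, p, hp, hpv⟩ := (aux_tilde v.1.1).1 v.1.2
      have hpk : p ≠ k := by rintro rfl; exact hv hpv
      have hpn := Nat.dvd_of_mem_primeFactors hp
      obtain ⟨vp, hvp⟩ := mk p p hp dvd_rfl (nd p hp hpk)
      obtain ⟨vi, hvi⟩ := mk i i hi dvd_rfl (nd i hi hik)
      obtain ⟨w, hw⟩ := mk (p * i) p hp (Dvd.intro _ rfl)
        (fun h => (hkp.dvd_mul.1 h).elim (nd p hp hpk) (nd i hi hik))
      have a1 := aux_reach S v vp (by rw [hvp]; exact (aux_mem hpn _).2 hpv)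
      have a2 := aux_reach S w vp (by
        rw [hvp, hw]; exact (aux_mem hpn _).2 ((aux_dvd_val_natCast hpn).2 (Dvd.intro _ rfl)))
      have a3 := aux_reach S w vi (by
        rw [hvi, hw]; exact (aux_mem hin _).2 ((aux_dvd_val_natCast hin).2 (Dvd.intro_left _ rfl)))
      have a4 := aux_reach S ⟨t, htS⟩ vi (by rw [hvi]; exact (aux_mem hin _).2 hti)
      have a5 := aux_reach S ⟨t, htS⟩ r ((aux_mem hkn _).2 htk)
      exact a1.trans (a2.symm.trans (a3.trans (a4.symm.trans a5)))
  intro u v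
  exact (main u).trans (main v).symm

theorem aux_le_one {V : Type*} {Γ : SimpleGraph V} (h : Γ.Preconnected) :
    numComponents Γ ≤ 1 := by
  have := h.subsingleton_connectedComponent
  exact Finite.card_le_one_iff_subsingleton.2 this

/-- If `n` has at least two prime factors and is not a product of two
distinct primes, then for every prime factor `k` of `n`, the union of the punctured
cyclic subgroups `⟨\overline{i·k}⟩ − {0̄}` over the other prime factors `i` of `n`
is a minimal separating set of `𝒢̃(ℤ_n)`. -/
theorem stmt4 (n : ℕ) (hn : 2 ≤ n.primeFactors.card)
    (hn2 : ¬ ∃ p q : ℕ, p.Prime ∧ q.Prime ∧ p ≠ q ∧ n = p * q) :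
    ∀ k ∈ n.primeFactors,
      IsMinimalSepSet (tildeGraph n)
        (Subtype.val ⁻¹' (⋃ i ∈ n.primeFactors.erase k,
          ((AddSubgroup.zmultiples (((i * k : ℕ) : ZMod n)) : Set (ZMod n)) \ {0}))) := by
  intro k hk
  have : NeZero n := ⟨by rintro rfl; simp at hk⟩
  have hT := aux_T hk
  set T : Set (tildeVerts n) := (Subtype.val ⁻¹' (⋃ i ∈ n.primeFactors.erase k,
          ((AddSubgroup.zmultiples (((i * k : ℕ) : ZMod n)) : Set (ZMod n)) \ {0}))) with hTdef
  clear_value T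
  have hkp := Nat.prime_of_mem_primeFactors hk
  have hkn := Nat.dvd_of_mem_primeFactors hk
  obtain ⟨i, hi, hik⟩ := Finset.exists_mem_ne (by omega : 1 < n.primeFactors.card) k
  have hip := Nat.prime_of_mem_primeFactors hi
  have hin := Nat.dvd_of_mem_primeFactors hi
  have hc := (Nat.coprime_primes hip hkp).2 hik
  have hd : i * k ∣ n := hc.mul_dvd_of_dvd_of_dvd hin hkn
  have hki : ¬ k ∣ i := fun h => hik ((Nat.prime_dvd_prime_iff_eq hkp hip).1 h).symm
  have hik' : ¬ i ∣ k := fun h => hik ((Nat.prime_dvd_prime_iff_eq hip hkp).1 h)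
  have ht1 : ((i * k : ℕ) : ZMod n) ∈ tildeVerts n := by
    refine (aux_tilde _).2 ⟨?_, k, hk, (aux_dvd_val_natCast hkn).2 (Dvd.intro_left _ rfl)⟩
    intro h0
    rw [ZMod.natCast_eq_zero_iff] at h0
    exact hn2 ⟨i, k, hip, hkp, hik, Nat.dvd_antisymm h0 hd⟩
  have ht2 : (⟨_, ht1⟩ : tildeVerts n) ∈ T := (hT _).2
    ⟨(aux_dvd_val_natCast hkn).2 (Dvd.intro_left _ rfl), i, hi, hik,
      (aux_dvd_val_natCast hin).2 (Dvd.intro _ rfl)⟩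
  have hconn : (tildeGraph n).Preconnected := by
    have h0 := aux_conn hk ∅ (by simp) ⟨_, ht1⟩ (by simp) ((hT _).1 ht2)
    intro u v
    exact (h0 ⟨u, by simp⟩ ⟨v, by simp⟩).map (SimpleGraph.Embedding.induce _).toHom
  refine ⟨?_, ?_⟩
  · refine lt_of_le_of_lt (aux_le_one hconn) ?_
    have hk1 : ((k : ℕ) : ZMod n) ∈ tildeVerts n := (aux_tilde _).2
      ⟨aux_ne hin hik', k, hk, (aux_dvd_val_natCast hkn).2 dvd_rfl⟩
    have hi1 : ((i : ℕ) : ZMod n) ∈ tildeVerts n := (aux_tilde _).2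
      ⟨aux_ne hkn hki, i, hi, (aux_dvd_val_natCast hin).2 dvd_rfl⟩
    have hk2 : (⟨_, hk1⟩ : tildeVerts n) ∉ T := by
      rw [hT]
      rintro ⟨-, j, hj, hjk, hjd⟩
      rw [aux_dvd_val_natCast (Nat.dvd_of_mem_primeFactors hj)] at hjd
      exact hjk ((Nat.prime_dvd_prime_iff_eq (Nat.prime_of_mem_primeFactors hj) hkp).1 hjd)
    have hi2 : (⟨_, hi1⟩ : tildeVerts n) ∉ T := by
      rw [hT]
      rintro ⟨h, -⟩
      exact hki ((aux_dvd_val_natCast hkn).1 h)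
    have step : ∀ u v : (Tᶜ : Set (tildeVerts n)), ((tildeGraph n).induce Tᶜ).Adj u v →
        k ∣ u.1.1.val → k ∣ v.1.1.val := by
      intro u v huv hu
      by_contra hv
      obtain ⟨-, p, hp, hpv⟩ := (aux_tilde v.1.1).1 v.1.2
      have hpk : p ≠ k := by rintro rfl; exact hv hpv
      have huv' : u.1.1 ∈ AddSubgroup.zmultiples v.1.1 ∨
        v.1.1 ∈ AddSubgroup.zmultiples u.1.1 := huv.2
      rcases huv' with h | h
      · exact u.2 ((hT _).2 ⟨hu, p, hp, hpk, aux_trans (Nat.dvd_of_mem_primeFactors hp) h hpv⟩)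
      · exact hv (aux_trans hkn h hu)
    have walk : ∀ u v : (Tᶜ : Set (tildeVerts n)), ((tildeGraph n).induce Tᶜ).Walk u v →
        k ∣ u.1.1.val → k ∣ v.1.1.val := by
      intro u v w
      induction w with
      | nil => exact id
      | cons h _ ih => exact fun hu => ih (step _ _ h hu)
    unfold numComponents
    rw [Finite.one_lt_card_iff_nontrivial]
    refine ⟨connectedComponentMk _ ⟨_, hk2⟩, connectedComponentMk _ ⟨_, hi2⟩, ?_⟩
    intro h
    obtain ⟨w⟩ := ConnectedComponent.exact h
    have := walk _ _ w ((aux_dvd_val_natCast hkn).2 dvd_rfl)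
    exact hki ((aux_dvd_val_natCast hkn).1 this)
  · intro S hST hne _ hsep
    obtain ⟨t, htT, htS⟩ := Set.exists_of_ssubset (hST.ssubset_of_ne hne)
    have h1 := aux_le_one (aux_conn hk S (fun x hx => (hT x).1 (hST hx)) t htS ((hT t).1 htT))
    have h2 : 0 < numComponents (tildeGraph n) := by
      have : Nonempty (tildeGraph n).ConnectedComponent := ⟨connectedComponentMk _ t⟩
      exact Nat.card_pos
    unfold IsSepSet at hsep
    omega
end

section
/- Let G be a finite group and x ∈ G. Then the following are equivalent: (i) N(x) is a separating set of 𝒢(G); (ii) N([x]) is a separating set of 𝒢(G); (iii) there exists y ∈ G, distinct from x, such that x and y are not adjacent in 𝒢(G). -/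
open SimpleGraph

theorem aux_adj {G : Type*} [Group G] {x a y : G} (ha : a ∈ simClass x)
    (h : (powerGraph G).Adj a y) (hy : y ≠ x) : (powerGraph G).Adj x y := by
  have ha' : Subgroup.zpowers a = Subgroup.zpowers x := ha
  refine ⟨hy.symm, ?_⟩
  rcases h.2 with h | h
  · left
    have : Subgroup.zpowers a ≤ Subgroup.zpowers y := Subgroup.zpowers_le.2 h
    rw [ha'] at this
    exact Subgroup.zpowers_le.1 this
  · right
    rwa [ha'] at h

theorem aux_main {G : Type*} [Group G] [Finite G] (x : G) (A : Set G) (hx : x ∈ A)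
    (hA : A ⊆ simClass x) :
    IsSepSet (powerGraph G) (setNbhd (powerGraph G) A) ↔
      ∃ y : G, y ≠ x ∧ ¬ (powerGraph G).Adj x y := by
  have h1 : numComponents (powerGraph G) = 1 := by
    unfold numComponents
    have hr : ∀ a : G, (powerGraph G).Reachable a 1 := by
      intro a
      by_cases h : a = 1
      · rw [h]
      · exact SimpleGraph.Adj.reachable ⟨h, Or.inr (Subgroup.one_mem _)⟩
    have hc : (powerGraph G).Preconnected := fun a b => (hr a).trans (hr b).symm
    have := hc.subsingleton_connectedComponent
    exact Nat.card_eq_one_iff_unique.2 ⟨this, ⟨(powerGraph G).connectedComponentMk 1⟩⟩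
  have hmem : ∀ a ∈ A, a ∈ (setNbhd (powerGraph G) A)ᶜ := fun a ha h => h.2 ha
  unfold IsSepSet
  rw [h1, numComponents, Finite.one_lt_card_iff_nontrivial]
  constructor
  · intro hn
    by_contra! hcon
    apply not_subsingleton_iff_nontrivial.2 hn
    have hr : ∀ v, ((powerGraph G).induce (setNbhd (powerGraph G) A)ᶜ).Reachable v
        ⟨x, hmem x hx⟩ := by
      rintro ⟨v, hv⟩
      by_cases h : v = x
      · subst h; rfl
      · exact SimpleGraph.Adj.reachable (hcon v h).symm
    have hc : ((powerGraph G).induce (setNbhd (powerGraph G) A)ᶜ).Preconnected :=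
      fun a b => (hr a).trans (hr b).symm
    exact hc.subsingleton_connectedComponent
  · rintro ⟨y, hy, hxy⟩
    have hcl : ∀ a ∈ A, (powerGraph G).Adj a y → False :=
      fun a ha h => hxy (aux_adj (hA ha) h hy)
    have hyA : y ∉ A := by
      intro h
      have e : Subgroup.zpowers y = Subgroup.zpowers x := hA h
      exact hxy ⟨hy.symm, Or.inr (e ▸ Subgroup.mem_zpowers y)⟩
    have hyT : y ∈ (setNbhd (powerGraph G) A)ᶜ := by
      rintro ⟨h, -⟩
      simp only [Set.mem_iUnion] at h
      obtain ⟨a, ha, h⟩ := h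
      exact hcl a ha h
    refine ⟨⟨SimpleGraph.connectedComponentMk _ ⟨x, hmem x hx⟩,
      SimpleGraph.connectedComponentMk _ ⟨y, hyT⟩, ?_⟩⟩
    intro h
    obtain ⟨w⟩ := SimpleGraph.ConnectedComponent.exact h
    have key : ∀ u v, ((powerGraph G).induce (setNbhd (powerGraph G) A)ᶜ).Walk u v →
        u.1 ∈ A → v.1 ∈ A := by
      intro u v w
      induction w with
      | nil => exact id
      | @cons u v w h p ih =>
        intro hu
        apply ih
        by_contra hv
        exact v.2 ⟨Set.mem_biUnion hu h, hv⟩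
    exact hyA (key _ _ w hx)

theorem aux_single {V : Type*} (Γ : SimpleGraph V) (x : V) :
    setNbhd Γ {x} = Γ.neighborSet x := by
  ext y
  simp only [setNbhd, Set.mem_singleton_iff, Set.iUnion_iUnion_eq_left, Set.mem_diff,
    SimpleGraph.mem_neighborSet]
  exact ⟨fun h => h.1, fun h => ⟨h, h.ne'⟩⟩

/-- For a finite group `G` and `x ∈ G`, TFAE:
(i) `N(x)` is a separating set of `𝒢(G)`;
(ii) `N([x])` is a separating set of `𝒢(G)`;
(iii) there exists `y ≠ x` not adjacent to `x` in `𝒢(G)`. -/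
theorem stmt8 {G : Type*} [Group G] [Finite G] (x : G) :
    (IsSepSet (powerGraph G) ((powerGraph G).neighborSet x) ↔
      ∃ y : G, y ≠ x ∧ ¬ (powerGraph G).Adj x y) ∧
    (IsSepSet (powerGraph G) (setNbhd (powerGraph G) (simClass x)) ↔
      ∃ y : G, y ≠ x ∧ ¬ (powerGraph G).Adj x y) := by
  refine ⟨?_, aux_main x _ rfl subset_rfl⟩
  rw [← aux_single]
  exact aux_main x {x} rfl (by rintro _ rfl; rfl)
end

section
/- Let G be a finite group and x ∈ G with order o(x) ≥ 3. Then N(x) is not a minimal separating set of the power graph 𝒢(G). -/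
open SimpleGraph

theorem pg_one_adj {G : Type*} [Group G] (y : G) (h : y ≠ 1) : (powerGraph G).Adj 1 y :=
  ⟨h.symm, Or.inl (Subgroup.one_mem _)⟩

theorem pg_numComponents {G : Type*} [Group G] [Finite G] :
    numComponents (powerGraph G) = 1 := by
  have hr : ∀ y : G, (powerGraph G).Reachable 1 y := by
    intro y
    by_cases h : y = 1
    · subst h; exact Reachable.refl _
    · exact (pg_one_adj y h).reachable
  have hc : (powerGraph G).Preconnected := fun a b => (hr a).symm.trans (hr b)
  have : Subsingleton (powerGraph G).ConnectedComponent := hc.subsingleton_connectedComponent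
  have : Nonempty (powerGraph G).ConnectedComponent :=
    ⟨(powerGraph G).connectedComponentMk 1⟩
  exact Nat.card_unique

/-- If `x` has order at least `3` in a finite group `G`, then `N(x)`
is not a minimal separating set of `𝒢(G)`. -/
theorem stmt9 {G : Type*} [Group G] [Finite G] (x : G) (hx : 3 ≤ orderOf x) :
    ¬ IsMinimalSepSet (powerGraph G) ((powerGraph G).neighborSet x) := by
  rintro ⟨hsep, hmin⟩
  have hx1 : x ≠ 1 := by
    rintro rfl
    simp at hx
  have hinv : x⁻¹ ≠ x := by
    intro h
    have h2 : x ^ 2 = 1 := by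
      rw [pow_two]; nth_rewrite 1 [← h]; simp
    have := orderOf_le_of_pow_eq_one (by norm_num) h2
    omega
  have hadj : (powerGraph G).Adj x x⁻¹ :=
    ⟨hinv.symm, Or.inr (Subgroup.inv_mem _ (Subgroup.mem_zpowers x))⟩
  -- a vertex outside the closed neighbourhood
  have hy : ∃ y : G, y ≠ x ∧ ¬ (powerGraph G).Adj x y := by
    by_contra! hcon
    unfold IsSepSet at hsep
    rw [pg_numComponents] at hsep
    unfold numComponents at hsep
    have hs : Subsingleton ((powerGraph G).induce
        ((powerGraph G).neighborSet x)ᶜ).ConnectedComponent := by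
      apply Preconnected.subsingleton_connectedComponent
      rintro ⟨a, ha⟩ ⟨b, hb⟩
      have ha' : a = x := by
        by_contra h
        exact ha (hcon a h)
      have hb' : b = x := by
        by_contra h
        exact hb (hcon b h)
      subst ha'
      subst hb'
      exact Reachable.refl _
    have := Finite.card_le_one_iff_subsingleton.mpr hs
    omega
  obtain ⟨y, hyx, hya⟩ := hy
  refine hmin ((powerGraph G).neighborSet x \ {x⁻¹}) Set.diff_subset ?_ ?_ ?_
  · intro h
    have : x⁻¹ ∈ (powerGraph G).neighborSet x := hadj
    rw [← h] at this
    exact this.2 rfl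
  · exact ⟨1, (pg_one_adj x hx1).symm, fun h => hx1 (inv_eq_one.mp (Eq.symm h))⟩
  · unfold IsSepSet
    rw [pg_numComponents]
    unfold numComponents
    set S := (powerGraph G).neighborSet x \ {x⁻¹} with hS
    have hxS : x ∈ Sᶜ := fun h => (powerGraph G).loopless.irrefl x h.1
    have hyS : y ∈ Sᶜ := fun h => hya h.1
    have key : ∀ u v : (Sᶜ : Set G), ((powerGraph G).induce Sᶜ).Reachable u v →
        (u.1 = x ∨ u.1 = x⁻¹) → (v.1 = x ∨ v.1 = x⁻¹) := by
      rintro u v ⟨w⟩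
      induction w with
      | nil => exact id
      | @cons a b c hab _ ih =>
        intro ha
        apply ih
        have hab' : (powerGraph G).Adj a.1 b.1 := hab
        by_contra hb
        push Not at hb
        refine b.2 ⟨?_, hb.2⟩
        rcases ha with ha | ha
        · rw [ha] at hab'; exact hab'
        · rw [ha] at hab'
          refine ⟨hb.1.symm, ?_⟩
          rcases hab'.2 with h | h
          · exact Or.inl (by simpa using h)
          · exact Or.inr (by simpa using h)
    rw [Finite.one_lt_card_iff_nontrivial]
    refine ⟨connectedComponentMk _ ⟨x, hxS⟩, connectedComponentMk _ ⟨y, hyS⟩, ?_⟩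
    intro h
    rcases key _ _ (ConnectedComponent.exact h) (Or.inl rfl) with h | h
    · exact hyx h
    · exact hya (by rw [show y = x⁻¹ from h]; exact hadj)
end

section
/- Suppose n is not a product of two primes and n = p_1^{α_1} p_2^{α_2} ⋯ p_r^{α_r}, where r ≥ 2, p_1 < p_2 < ⋯ < p_r are primes and α_i ∈ ℕ. Then κ(𝒢(ℤ_n)) ≤ φ(n) + n/p_r^{α_r} + φ(n/p_r^{α_r}) · (p_r^{α_r −1} − 2). -/
open SimpleGraph

open Classical in
lemma aux_count {n : ℕ} [NeZero n] (T : Finset ℕ) (hT : T ⊆ n.divisors) :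
    (Finset.univ.filter (fun x : ZMod n => addOrderOf x ∈ T)).card = ∑ d ∈ T, Nat.totient d := by
  rw [Finset.card_eq_sum_card_fiberwise (f := fun x : ZMod n => addOrderOf x) (t := T)]
  · apply Finset.sum_congr rfl
    intro d hd
    have hdn : d ∣ Fintype.card (ZMod n) := by
      rw [ZMod.card]; exact Nat.dvd_of_mem_divisors (hT hd)
    rw [← IsAddCyclic.card_addOrderOf_eq_totient (α := ZMod n) (by simpa using hdn)]
    congr 1
    ext x
    simp only [Finset.mem_filter, Finset.mem_univ, true_and]
    constructor
    · rintro ⟨_, h⟩; exact h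
    · intro h; exact ⟨h ▸ hd, h⟩
  · intro x hx
    simpa using hx

open Classical in
lemma aux_card {m q : ℕ} [NeZero (m * q)] (hc : Nat.Coprime m q) :
    ({x : ZMod (m * q) | (addOrderOf x ∣ m ∨ m ∣ addOrderOf x) ∧ addOrderOf x ≠ m}).ncard
      + 2 * Nat.totient m = m + Nat.totient m * q := by
  have hne : m * q ≠ 0 := NeZero.ne _
  have hm : m ≠ 0 := left_ne_zero_of_mul hne
  have hq : q ≠ 0 := right_ne_zero_of_mul hne
  have hord : ∀ x : ZMod (m * q), addOrderOf x ∈ (m * q).divisors := by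
    intro x
    rw [Nat.mem_divisors]
    refine ⟨?_, hne⟩
    have := addOrderOf_dvd_card (x := x)
    rwa [ZMod.card] at this
  have hA := aux_count (n := m * q) m.divisors (Nat.divisors_subset_of_dvd hne (Dvd.intro _ rfl))
  rw [Nat.sum_totient] at hA
  have hC := aux_count (n := m * q) {m} (by simp [hm, hq])
  rw [Finset.sum_singleton] at hC
  have hB := aux_count (n := m * q) (q.divisors.image (fun d => m * d)) (by
    intro e he
    simp only [Finset.mem_image, Nat.mem_divisors] at he ⊢
    obtain ⟨d, hd, rfl⟩ := he
    exact ⟨Nat.mul_dvd_mul_left m hd.1, hne⟩)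
  rw [Finset.sum_image (fun a _ b _ h => Nat.eq_of_mul_eq_mul_left (Nat.pos_of_ne_zero hm) h)] at hB
  have hsum : ∑ d ∈ q.divisors, Nat.totient (m * d) = Nat.totient m * q := by
    conv_rhs => rw [← Nat.sum_totient q]
    rw [Finset.mul_sum]
    apply Finset.sum_congr rfl
    intro d hd
    exact Nat.totient_mul (hc.coprime_dvd_right (Nat.dvd_of_mem_divisors hd))
  rw [hsum] at hB
  set A := Finset.univ.filter (fun x : ZMod (m * q) => addOrderOf x ∈ m.divisors) with hAdef
  set B := Finset.univ.filter
    (fun x : ZMod (m * q) => addOrderOf x ∈ q.divisors.image (fun d => m * d)) with hBdef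
  set C := Finset.univ.filter (fun x : ZMod (m * q) => addOrderOf x ∈ ({m} : Finset ℕ)) with hCdef
  have mA : ∀ x, x ∈ A ↔ addOrderOf x ∣ m := by intro x; simp [hAdef, hm]
  have mC : ∀ x, x ∈ C ↔ addOrderOf x = m := by intro x; simp [hCdef]
  have mB : ∀ x, x ∈ B ↔ m ∣ addOrderOf x := by
    intro x
    simp only [hBdef, Finset.mem_filter, Finset.mem_univ, true_and, Finset.mem_image]
    constructor
    · rintro ⟨d, _, h⟩; exact ⟨d, h.symm⟩
    · rintro ⟨d, h⟩
      refine ⟨d, ?_, h.symm⟩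
      have := Nat.dvd_of_mem_divisors (hord x)
      rw [h] at this
      exact Nat.mem_divisors.2 ⟨Nat.dvd_of_mul_dvd_mul_left (Nat.pos_of_ne_zero hm) this, hq⟩
  have hI : A ∩ B = C := by
    ext x
    rw [Finset.mem_inter, mA, mB, mC]
    exact ⟨fun h => Nat.dvd_antisymm h.1 h.2, fun h => ⟨h.dvd, h.symm.dvd⟩⟩
  have hU := Finset.card_union_add_card_inter A B
  have hCU : C ⊆ A ∪ B := hI ▸ (Finset.inter_subset_left.trans Finset.subset_union_left)
  have hS := Finset.card_sdiff_add_card_eq_card hCU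
  have hSet : {x : ZMod (m * q) | (addOrderOf x ∣ m ∨ m ∣ addOrderOf x) ∧ addOrderOf x ≠ m}
      = (((A ∪ B) \ C : Finset (ZMod (m * q))) : Set (ZMod (m * q))) := by
    ext x
    rw [Finset.mem_coe, Finset.mem_sdiff, Finset.mem_union, mA, mB, mC]
    rfl
  rw [hSet, Set.ncard_coe_finset]
  rw [hI] at hU
  omega

lemma aux_exists {n : ℕ} [NeZero n] {d : ℕ} (hd : d ∣ n) : ∃ x : ZMod n, addOrderOf x = d := by
  classical
  have h := IsAddCyclic.card_addOrderOf_eq_totient (α := ZMod n) (d := d) (by simpa using hd)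
  have hpos : 0 < Nat.totient d :=
    Nat.totient_pos.2 (Nat.pos_of_dvd_of_pos hd (Nat.pos_of_ne_zero (NeZero.ne n)))
  rw [← h] at hpos
  obtain ⟨x, hx⟩ := Finset.card_pos.1 hpos
  exact ⟨x, by simpa using hx⟩

lemma aux_kappa {m q P : ℕ} (hne : m * q ≠ 0) (hc : Nat.Coprime m q) (hm1 : m ≠ 1)
    (hP : P.Prime) (hPq : P ∣ q) :
    kappa (powerGraphZ (m * q)) + 2 * Nat.totient m ≤ m + Nat.totient m * q := by
  have : NeZero (m * q) := ⟨hne⟩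
  rw [← aux_card hc]
  gcongr
  apply Nat.sInf_le
  refine ⟨_, rfl, Or.inl ?_⟩
  intro hpre
  have hPm : ¬ P ∣ m := fun h => hP.one_lt.ne' (Nat.dvd_one.1 (hc ▸ Nat.dvd_gcd h hPq))
  obtain ⟨u, hu⟩ := aux_exists (n := m * q) (Dvd.intro q rfl : m ∣ m * q)
  obtain ⟨v, hv⟩ := aux_exists (n := m * q) (hPq.mul_left m : P ∣ m * q)
  have hmP : ¬ m ∣ P := by
    intro h
    rcases (Nat.dvd_prime hP).1 h with h | h
    · exact hm1 h
    · exact hPm (h ▸ dvd_rfl)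
  have hr := hpre ⟨u, fun h => h.2 hu⟩ ⟨v, by
    rintro ⟨h | h, -⟩
    · exact hPm (hv ▸ h)
    · exact hmP (hv ▸ h)⟩
  rw [SimpleGraph.reachable_iff_reflTransGen] at hr
  have key : ∀ w : ({x : ZMod (m * q) | (addOrderOf x ∣ m ∨ m ∣ addOrderOf x) ∧
      addOrderOf x ≠ m}ᶜ : Set (ZMod (m * q))), Relation.ReflTransGen
        (SimpleGraph.induce _ (powerGraphZ (m * q))).Adj ⟨u, fun h => h.2 hu⟩ w →
      addOrderOf w.1 = m := by
    intro w hw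
    induction hw with
    | refl => exact hu
    | @tail b c _ hadj ih =>
      have h2 : b.1 ≠ c.1 ∧ (b.1 ∈ AddSubgroup.zmultiples c.1 ∨ c.1 ∈ AddSubgroup.zmultiples b.1) := hadj
      by_contra hcm
      apply c.2
      refine ⟨?_, hcm⟩
      rcases h2.2 with h | h
      · exact Or.inr (ih.symm.dvd.trans (addOrderOf_dvd_of_mem_zmultiples h))
      · exact Or.inl ((addOrderOf_dvd_of_mem_zmultiples h).trans ih.dvd)
  have := key _ hr
  exact hPm (by rw [← this]; exact hv ▸ dvd_rfl)

/-- If `n` has at least two prime factors, is not a product of two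
primes, and `P` is its largest prime factor with multiplicity `α_r`, then
`κ(𝒢(ℤ_n)) ≤ φ(n) + n/P^{α_r} + φ(n/P^{α_r})·(P^{α_r−1} − 2)` (in `ℤ`). -/
theorem stmt12 (n : ℕ) (hn : 2 ≤ n.primeFactors.card)
    (hn2 : ¬ ∃ p q : ℕ, p.Prime ∧ q.Prime ∧ n = p * q)
    (P : ℕ) (hP : P ∈ n.primeFactors) (hPmax : ∀ q ∈ n.primeFactors, q ≤ P) :
    (kappa (powerGraphZ n) : ℤ) ≤
      (Nat.totient n : ℤ) + ((n / P ^ n.factorization P : ℕ) : ℤ)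
        + (Nat.totient (n / P ^ n.factorization P) : ℤ)
          * ((P : ℤ) ^ (n.factorization P - 1) - 2) := by
  have hPp := Nat.prime_of_mem_primeFactors hP
  have hPn := Nat.dvd_of_mem_primeFactors hP
  have hn0 : n ≠ 0 := (Nat.mem_primeFactors.1 hP).2.2
  have ha : 0 < n.factorization P := hPp.factorization_pos_of_dvd hn0 hPn
  have hc : Nat.Coprime (n / P ^ n.factorization P) (P ^ n.factorization P) :=
    (Nat.Coprime.pow_left _ (Nat.coprime_ordCompl hPp hn0)).symm
  have hmul : n / P ^ n.factorization P * P ^ n.factorization P = n :=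
    Nat.div_mul_cancel (Nat.ordProj_dvd n P)
  have hm1 : n / P ^ n.factorization P ≠ 1 := by
    intro h
    rw [h, one_mul] at hmul
    rw [← hmul, Nat.primeFactors_prime_pow ha.ne' hPp] at hn
    simp at hn
  have hk := aux_kappa (P := P) (by rw [hmul]; exact hn0) hc hm1 hPp (dvd_pow_self P ha.ne')
  have ht : Nat.totient n = Nat.totient (n / P ^ n.factorization P)
      * (P ^ (n.factorization P - 1) * (P - 1)) := by
    rw [← Nat.totient_prime_pow hPp ha, ← Nat.totient_mul hc, hmul]
  rw [hmul] at hk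
  rw [ht]
  generalize n / P ^ n.factorization P = m at *
  obtain ⟨b, hb⟩ : ∃ b, n.factorization P = b + 1 := ⟨_, (Nat.succ_pred_eq_of_pos ha).symm⟩
  rw [hb] at hk ⊢
  zify at hk
  push_cast [Nat.cast_sub hPp.one_le] at hk ⊢
  rw [pow_succ] at hk
  linarith
end
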